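/- arXiv:2306.13801 — 2 statements merged into one kernel-verified Lean document; each statement's English description precedes it below -/
import Mathlib

section
/- Let μ^{XY} and π^{XY} be probability measures on a product of standard Borel spaces X × Y with μ^{XY} ≪ π^{XY}, with X-marginals μ^X, π^X and regular conditional distributions μ^{Y|X=x}, π^{Y|X=x}. If μ^{Y|X=x} = π^{Y|X=x} for μ^X-almost every x, then D_KL(μ^{XY} ‖ π^{XY}) = D_KL(μ^X ‖ π^X). -/
open MeasureTheory ProbabilityTheory
open scoped ENNReal Classical

noncomputable section

/-- Kullback–Leibler divergence `D_KL(μ ‖ ν) = ∫ log(dμ/dν) dμ` (valued in `[0,∞]`,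
with the convention that it is `∞` when `μ` is not absolutely continuous w.r.t. `ν`;
for `μ ≪ ν` it is computed via the nonnegative integrand `f log f − f + 1`,
`f = dμ/dν`, integrated against `ν`). -/
def klDiv {X : Type*} [MeasurableSpace X] (μ ν : Measure X) : ℝ≥0∞ :=
  if μ ≪ ν then
    ∫⁻ x, ENNReal.ofReal ((μ.rnDeriv ν x).toReal * Real.log (μ.rnDeriv ν x).toReal
      - (μ.rnDeriv ν x).toReal + 1) ∂ν
  else ⊤

theorem klDiv_eq_informationTheory_klDiv {X : Type*} [MeasurableSpace X] (μ ν : Measure X)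
    [IsFiniteMeasure μ] [IsFiniteMeasure ν] : klDiv μ ν = InformationTheory.klDiv μ ν := by
  simp only [klDiv, InformationTheory.klDiv_eq_lintegral_klFun, InformationTheory.klFun_apply,
    sub_add_eq_add_sub]

/-- if the conditional distributions of `μ` and `ν` agree `μ^X`-a.e.,
then `D_KL(μ ‖ ν) = D_KL(μ^X ‖ ν^X)`. -/
theorem kl_eq_kl_fst_of_condKernel_eq {X Y : Type*}
    [MeasurableSpace X] [StandardBorelSpace X]
    [MeasurableSpace Y] [StandardBorelSpace Y] [Nonempty Y]
    (μ ν : Measure (X × Y)) [IsProbabilityMeasure μ] [IsProbabilityMeasure ν]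
    (hac : μ ≪ ν)
    (hcond : ∀ᵐ x ∂μ.fst, μ.condKernel x = ν.condKernel x) :
    klDiv μ ν = klDiv μ.fst ν.fst := by
  have h : μ.fst ⊗ₘ ν.condKernel = μ := by
    rw [← Measure.compProd_congr hcond, μ.disintegrate]
  rw [klDiv_eq_informationTheory_klDiv, klDiv_eq_informationTheory_klDiv,
    ← InformationTheory.klDiv_compProd_left μ.fst ν.fst ν.condKernel, h, ν.disintegrate]

end
end

section
/- (Strong log-concavity of the interpolated marginal over a bipartite graph.) Let n, m, d ≥ 1, η > 0, t ∈ (0,1). For i = 1,…,n let f_i : ℝ^d → ℝ be α_{f_i}-strongly convex, for j = 1,…,m let g_j : ℝ^d → ℝ be α_{g_j}-strongly convex (all constants positive), with exp(−f_i), exp(−g_j) integrable. Let σ_{ij} ∈ [0,1] with Σ_{i=1}^n σ_{ij} > 0 for every j and Σ_{j=1}^m σ_{ij} > 0 for every i. Define, for z = (z^1,…,z^m) ∈ (ℝ^d)^m, π_t(z) proportional to ∫∫ exp(−Σ_i f_i(x_i) − Σ_j g_j(y_j) − Σ_{i,j} (σ_{ij}/(2η)) ‖x_i − y_j‖²) ·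 exp(−Σ_{j=1}^m (Σ_i σ_{ij})/(2t(1−t)η) · ‖z^j − t y_j − (1−t)(Σ_i σ_{ij} x_i)/(Σ_i σ_{ij})‖²) dx dy. Then z ↦ −log π_t(z) is strongly convex on (ℝ^d)^m with constant c_t = [ η t(1−t)/min_j Σ_{i=1}^n σ_{ij} + m n (1−t)²/min_i α_{f_i} + t²/min_j α_{g_j} ]^{−1}. -/
open MeasureTheory Real

noncomputable section

open Set ENNReal in
/-- One-dimensional Brunn–Minkowski inequality for measurable sets. -/
theorem volume_add_volume_le_of_add_mem {A B C : Set ℝ} (hA : MeasurableSet A)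
    (hB : MeasurableSet B) (hA' : A.Nonempty) (hB' : B.Nonempty)
    (hC : ∀ x ∈ A, ∀ y ∈ B, x + y ∈ C) : volume A + volume B ≤ volume C := by
  have key : ∀ K ⊆ A, IsCompact K → ∀ L ⊆ B, IsCompact L → K.Nonempty → L.Nonempty →
      volume K + volume L ≤ volume C := by
    intro K hKA hK L hLB hL hK' hL'
    obtain ⟨u, hu⟩ := hK.exists_isGreatest hK'
    obtain ⟨v, hv⟩ := hL.exists_isLeast hL'
    have hdisj : AEDisjoint volume ((fun x => x + v) '' K) ((fun y => u + y) '' L) := by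
      refine measure_mono_null (t := {u + v}) ?_ (by simp)
      rintro _ ⟨⟨x, hx, rfl⟩, ⟨y, hy, hxy⟩⟩
      have h1 := hu.2 hx
      have h2 := hv.2 hy
      simp only [mem_singleton_iff] at *
      linarith
    have hmeas : MeasurableSet ((fun y => u + y) '' L) :=
      (hL.image (continuous_const_add u)).measurableSet
    calc volume K + volume L
        = volume ((fun x => x + v) '' K) + volume ((fun y => u + y) '' L) := by
          simp
      _ = volume (((fun x => x + v) '' K) ∪ ((fun y => u + y) '' L)) :=
          (measure_union₀ hmeas.nullMeasurableSet hdisj).symm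
      _ ≤ volume C := by
          refine measure_mono ?_
          rintro _ (⟨x, hx, rfl⟩ | ⟨y, hy, rfl⟩)
          · exact hC _ (hKA hx) _ (hLB hv.1)
          · exact hC _ (hKA hu.1) _ (hLB hy)
  have inner : ∀ S : Set ℝ, MeasurableSet S → S.Nonempty →
      volume S ≤ ⨆ K, ⨆ _ : K ⊆ S ∧ IsCompact K ∧ K.Nonempty, volume K := by
    rintro S hS ⟨p, hp⟩
    refine le_of_forall_lt fun r hr => ?_
    obtain ⟨K, hKS, hK, hrK⟩ := hS.exists_lt_isCompact hr
    exact (hrK.trans_le (measure_mono (subset_insert p K))).trans_le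
      (le_iSup₂_of_le (insert p K) ⟨insert_subset hp hKS, hK.insert p, insert_nonempty _ _⟩ le_rfl)
  refine (add_le_add (inner A hA hA') (inner B hB hB')).trans ?_
  have nonempty : ∀ S : Set ℝ, S.Nonempty → ∃ K : Set ℝ, K ⊆ S ∧ IsCompact K ∧ K.Nonempty :=
    fun S ⟨p, hp⟩ => ⟨{p}, singleton_subset_iff.2 hp, isCompact_singleton, singleton_nonempty p⟩
  exact biSup_add_biSup_le' (nonempty A hA') (nonempty B hB') fun K hK L hL =>
    key K hK.1 hK.2.1 L hL.1 hL.2.1 hK.2.2 hL.2.2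

open Pointwise in
/-- One-dimensional Brunn–Minkowski inequality with weights. -/
theorem ofReal_mul_volume_add_le {A B C : Set ℝ} (hA : MeasurableSet A)
    (hB : MeasurableSet B) (hA' : A.Nonempty) (hB' : B.Nonempty) {a b : ℝ} (ha : 0 < a)
    (hb : 0 < b) (hC : ∀ x ∈ A, ∀ y ∈ B, a * x + b * y ∈ C) :
    ENNReal.ofReal a * volume A + ENNReal.ofReal b * volume B ≤ volume C := by
  have := volume_add_volume_le_of_add_mem (C := C) (hA.const_smul₀ a) (hB.const_smul₀ b)
    (hA'.smul_set (a := a)) (hB'.smul_set (a := b)) (by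
      rintro _ ⟨x, hx, rfl⟩ _ ⟨y, hy, rfl⟩
      exact hC x hx y hy)
  simpa [Measure.addHaar_smul, abs_of_pos ha, abs_of_pos hb] using this

open Set in
/-- The Prékopa–Leindler inequality on the line, in arithmetic-mean form, for functions
normalised to have supremum `1`. -/
theorem lintegral_add_le_of_rpow_mul_le {a b : ℝ} (ha : 0 < a) (hb : 0 < b) (hab : a + b = 1)
    {f g h : ℝ → ℝ} (hf : Measurable f) (hg : Measurable g) (hh : Measurable h)
    (hf0 : ∀ x, 0 ≤ f x) (hg0 : ∀ x, 0 ≤ g x) (hh0 : ∀ x, 0 ≤ h x)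
    (hf1 : ∀ x, f x ≤ 1) (hg1 : ∀ x, g x ≤ 1)
    (hfs : ∀ r < 1, ∃ x, r < f x) (hgs : ∀ r < 1, ∃ x, r < g x)
    (hfgh : ∀ x y, f x ^ a * g y ^ b ≤ h (a * x + b * y)) :
    ENNReal.ofReal a * (∫⁻ x, ENNReal.ofReal (f x)) +
        ENNReal.ofReal b * (∫⁻ x, ENNReal.ofReal (g x))
      ≤ ∫⁻ x, ENNReal.ofReal (h x) := by
  have meas : ∀ u : ℝ → ℝ, Measurable fun r : ℝ => volume {x | r < u x} := fun u =>
    Antitone.measurable fun r q hrq => measure_mono fun x hx => lt_of_le_of_lt hrq hx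
  rw [lintegral_eq_lintegral_meas_lt _ (ae_of_all _ hf0) hf.aemeasurable,
    lintegral_eq_lintegral_meas_lt _ (ae_of_all _ hg0) hg.aemeasurable,
    lintegral_eq_lintegral_meas_lt _ (ae_of_all _ hh0) hh.aemeasurable,
    ← lintegral_const_mul _ (meas f), ← lintegral_const_mul _ (meas g),
    ← lintegral_add_left ((meas f).const_mul _)]
  refine setLIntegral_mono' measurableSet_Ioi fun r hr => ?_
  have hr : 0 < r := hr
  rcases lt_or_ge r 1 with h1 | h1
  · refine ofReal_mul_volume_add_le (measurableSet_lt measurable_const hf)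
      (measurableSet_lt measurable_const hg) (hfs r h1) (hgs r h1) ha hb ?_
    intro x hx y hy
    refine lt_of_lt_of_le ?_ (hfgh x y)
    calc r = r ^ a * r ^ b := by rw [← Real.rpow_add hr, hab, Real.rpow_one]
      _ < f x ^ a * g y ^ b := mul_lt_mul'' (Real.rpow_lt_rpow hr.le hx ha)
          (Real.rpow_lt_rpow hr.le hy hb) (by positivity) (by positivity)
  · have e : ∀ u : ℝ → ℝ, (∀ x, u x ≤ 1) → {x | r < u x} = ∅ := fun u hu => by
      ext x; simpa using (hu x).trans h1
    simp [e f hf1, e g hg1]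

theorem ENNReal.rpow_mul_rpow_le_add {a b : ℝ} (ha : 0 < a) (hb : 0 < b) (hab : a + b = 1)
    (u v : ENNReal) : u ^ a * v ^ b ≤ ENNReal.ofReal a * u + ENNReal.ofReal b * v := by
  induction u with
  | top => simp [ENNReal.mul_top, ha]
  | coe u =>
    induction v with
    | top => simp [ENNReal.mul_top, hb]
    | coe v =>
      have := NNReal.geom_mean_le_arith_mean2_weighted ⟨a, ha.le⟩ ⟨b, hb.le⟩ u v (by ext; exact hab)
      rw [← ENNReal.coe_rpow_of_nonneg _ ha.le, ← ENNReal.coe_rpow_of_nonneg _ hb.le,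
        ENNReal.ofReal_eq_coe_nnreal ha.le, ENNReal.ofReal_eq_coe_nnreal hb.le]
      exact_mod_cast this

/-- The measure `μ` satisfies the Prékopa–Leindler inequality. -/
def PrekopaLeindler {E : Type*} [AddCommGroup E] [Module ℝ E] [MeasurableSpace E]
    (μ : Measure E) : Prop :=
  ∀ ⦃a b : ℝ⦄, 0 < a → 0 < b → a + b = 1 → ∀ ⦃f g h : E → ENNReal⦄,
    Measurable f → Measurable g → Measurable h →
    (∀ x y, f x ^ a * g y ^ b ≤ h (a • x + b • y)) →
    (∫⁻ x, f x ∂μ) ^ a * (∫⁻ x, g x ∂μ) ^ b ≤ ∫⁻ x, h x ∂μ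

theorem lintegral_rpow_mul_le_of_bounded {a b : ℝ} (ha : 0 < a) (hb : 0 < b) (hab : a + b = 1)
    {f g h : ℝ → ENNReal} (hf : Measurable f) (hg : Measurable g) (hh : Measurable h)
    (hfb : ⨆ x, f x ≠ ⊤) (hgb : ⨆ x, g x ≠ ⊤)
    (hfgh : ∀ x y, f x ^ a * g y ^ b ≤ h (a • x + b • y)) :
    (∫⁻ x, f x) ^ a * (∫⁻ x, g x) ^ b ≤ ∫⁻ x, h x := by
  set A := ⨆ x, f x
  set B := ⨆ x, g x
  rcases eq_or_ne A 0 with hA | hA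
  · have : f = 0 := funext fun x => by simpa using (le_iSup f x).trans hA.le
    simp [this, ha]
  rcases eq_or_ne B 0 with hB | hB
  · have : g = 0 := funext fun x => by simpa using (le_iSup g x).trans hB.le
    simp [this, hb]
  have hC0 : A ^ a * B ^ b ≠ 0 := by
    simp [ENNReal.rpow_eq_zero_iff, hA, hB, hfb, hgb]
  have hCt : A ^ a * B ^ b ≠ ⊤ := ENNReal.mul_ne_top
    (ENNReal.rpow_ne_top_of_nonneg ha.le hfb) (ENNReal.rpow_ne_top_of_nonneg hb.le hgb)
  have le_one : ∀ u : ℝ → ENNReal, ∀ x, u x / (⨆ y, u y) ≤ 1 := fun u x =>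
    ENNReal.div_le_of_le_mul (by simpa using le_iSup u x)
  have ofReal_eq : ∀ u : ℝ → ENNReal, ∀ x,
      ENNReal.ofReal (u x / (⨆ y, u y)).toReal = u x / (⨆ y, u y) := fun u x =>
    ENNReal.ofReal_toReal ((le_one u x).trans_lt ENNReal.one_lt_top).ne
  have exists_lt : ∀ u : ℝ → ENNReal, ⨆ y, u y ≠ 0 → ⨆ y, u y ≠ ⊤ → ∀ r < (1 : ℝ),
      ∃ x, r < (u x / (⨆ y, u y)).toReal := by
    intro u hu0 hut r hr
    have h1 : ENNReal.ofReal r * (⨆ y, u y) < ⨆ y, u y := by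
      conv_rhs => rw [← one_mul (⨆ y, u y)]
      exact ENNReal.mul_lt_mul_left hu0 hut (by simpa using hr)
    obtain ⟨x, hx⟩ := lt_iSup_iff.1 h1
    refine ⟨x, ?_⟩
    by_contra! hle
    refine hx.not_ge ((ENNReal.div_le_iff hu0 hut).1 ?_)
    exact (ENNReal.le_ofReal_iff_toReal_le ((le_one u x).trans_lt ENNReal.one_lt_top).ne
      (ENNReal.toReal_nonneg.trans hle)).2 hle
  have key := lintegral_add_le_of_rpow_mul_le ha hb hab
    (f := fun x => (f x / A).toReal) (g := fun x => (g x / B).toReal)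
    (h := fun x => (min (h x / (A ^ a * B ^ b)) 1).toReal)
    (by fun_prop) (by fun_prop) (by fun_prop) (fun _ => by positivity) (fun _ => by positivity)
    (fun _ => by positivity)
    (fun x => ENNReal.toReal_le_of_le_ofReal one_pos.le (by simpa using le_one f x))
    (fun x => ENNReal.toReal_le_of_le_ofReal one_pos.le (by simpa using le_one g x))
    (exists_lt f hA hfb) (exists_lt g hB hgb) (by
      intro x y
      rw [ENNReal.toReal_rpow, ENNReal.toReal_rpow, ← ENNReal.toReal_mul]
      refine ENNReal.toReal_mono (by simp) (le_min ?_ ?_)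
      · rw [ENNReal.div_rpow_of_nonneg _ _ ha.le, ENNReal.div_rpow_of_nonneg _ _ hb.le,
          ENNReal.le_div_iff_mul_le (.inl hC0) (.inl hCt)]
        refine le_trans (le_of_eq ?_) (hfgh x y)
        rw [mul_comm (A ^ a), div_eq_mul_inv, div_eq_mul_inv]
        calc f x ^ a * (A ^ a)⁻¹ * (g y ^ b * (B ^ b)⁻¹) * (B ^ b * A ^ a)
            = f x ^ a * g y ^ b * (A ^ a * (A ^ a)⁻¹) * (B ^ b * (B ^ b)⁻¹) := by ring
          _ = f x ^ a * g y ^ b := by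
            rw [ENNReal.mul_inv_cancel (by simp [hA, hfb]) (by simp [hA, hfb]),
              ENNReal.mul_inv_cancel (by simp [hB, hgb]) (by simp [hB, hgb]),
              mul_one, mul_one]
      · exact mul_le_one' (ENNReal.rpow_le_one (le_one f x) ha.le)
          (ENNReal.rpow_le_one (le_one g y) hb.le))
  simp only [A, B, ofReal_eq] at key
  have rescale : ∀ u : ℝ → ENNReal, Measurable u → ∀ c : ENNReal, c ≠ 0 → c ≠ ⊤ →
      c * ∫⁻ x, u x / c = ∫⁻ x, u x := by
    intro u hu c hc hc'
    rw [← lintegral_const_mul _ (by fun_prop)]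
    exact lintegral_congr fun x => ENNReal.mul_div_cancel hc hc'
  calc (∫⁻ x, f x) ^ a * (∫⁻ x, g x) ^ b
      = A ^ a * B ^ b * ((∫⁻ x, f x / A) ^ a * (∫⁻ x, g x / B) ^ b) := by
        rw [← rescale f hf A hA hfb, ← rescale g hg B hB hgb,
          ENNReal.mul_rpow_of_nonneg _ _ ha.le, ENNReal.mul_rpow_of_nonneg _ _ hb.le]
        ring
    _ ≤ A ^ a * B ^ b * ∫⁻ x, h x / (A ^ a * B ^ b) := by
        gcongr
        refine (ENNReal.rpow_mul_rpow_le_add ha hb hab _ _).trans (key.trans ?_)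
        exact lintegral_mono fun x => ENNReal.ofReal_toReal_le.trans (min_le_left _ _)
    _ = ∫⁻ x, h x := rescale h hh _ hC0 hCt

/-- The Prékopa–Leindler inequality on the line. -/
theorem prekopaLeindler_real : PrekopaLeindler (volume : Measure ℝ) := by
  intro a b ha hb hab f g h hf hg hh hfgh
  have trunc : ∀ u : ℝ → ENNReal, Measurable u →
      ∫⁻ x, u x = ⨆ n : ℕ, ∫⁻ x, min (u x) n := by
    intro u hu
    rw [← lintegral_iSup (f := fun (n : ℕ) x => min (u x) n) (fun n => hu.min measurable_const)
      fun n k hnk x => min_le_min_left _ (by exact_mod_cast hnk)]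
    refine lintegral_congr fun x => ?_
    rw [← inf_iSup_eq, ENNReal.iSup_natCast, inf_top_eq]
  have mono : ∀ u : ℝ → ENNReal, ∀ c : ℝ, 0 < c →
      Monotone fun n : ℕ => (∫⁻ x, min (u x) n) ^ c := fun u c hc n k hnk =>
    ENNReal.rpow_le_rpow (lintegral_mono fun x => min_le_min_left _ (by exact_mod_cast hnk)) hc.le
  have rpow_iSup : ∀ (u : ℕ → ENNReal) (c : ℝ), 0 < c → (⨆ n, u n) ^ c = ⨆ n, u n ^ c :=
    fun u c hc => (ENNReal.orderIsoRpow c hc).map_iSup u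
  rw [trunc f hf, trunc g hg, rpow_iSup _ _ ha, rpow_iSup _ _ hb, ENNReal.iSup_mul]
  simp_rw [ENNReal.mul_iSup]
  refine iSup₂_le fun i j => (mul_le_mul' (mono f a ha (le_max_left i j))
    (mono g b hb (le_max_right i j))).trans ?_
  refine lintegral_rpow_mul_le_of_bounded ha hb hab (hf.min measurable_const)
    (hg.min measurable_const) hh ?_ ?_ fun x y => le_trans ?_ (hfgh x y)
  · exact ((iSup_le fun x => min_le_right _ _).trans_lt (ENNReal.natCast_lt_top _)).ne
  · exact ((iSup_le fun x => min_le_right _ _).trans_lt (ENNReal.natCast_lt_top _)).ne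
  · gcongr <;> exact min_le_left _ _

/-- The Prékopa–Leindler inequality tensorizes. -/
theorem PrekopaLeindler.prod {E F : Type*} [AddCommGroup E] [Module ℝ E] [MeasurableSpace E]
    [AddCommGroup F] [Module ℝ F] [MeasurableSpace F] {μ : Measure E} {ν : Measure F}
    [SFinite ν] (hμ : PrekopaLeindler μ) (hν : PrekopaLeindler ν) :
    PrekopaLeindler (μ.prod ν) := by
  intro a b ha hb hab f g h hf hg hh hfgh
  rw [lintegral_prod _ hf.aemeasurable, lintegral_prod _ hg.aemeasurable,
    lintegral_prod _ hh.aemeasurable]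
  refine hμ ha hb hab hf.lintegral_prod_right' hg.lintegral_prod_right' hh.lintegral_prod_right'
    fun x x' => ?_
  exact hν ha hb hab (hf.comp measurable_prodMk_left) (hg.comp measurable_prodMk_left)
    (hh.comp measurable_prodMk_left) fun y y' => hfgh (x, y) (x', y')

theorem PrekopaLeindler.of_measurePreserving {E F : Type*} [AddCommGroup E] [Module ℝ E]
    [MeasurableSpace E] [AddCommGroup F] [Module ℝ F] [MeasurableSpace F] {μ : Measure E}
    {ν : Measure F} (hμ : PrekopaLeindler μ) {e : E → F} (he : MeasurePreserving e μ ν)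
    (hlin : ∀ (a b : ℝ) (x y : E), e (a • x + b • y) = a • e x + b • e y) :
    PrekopaLeindler ν := by
  intro a b ha hb hab f g h hf hg hh hfgh
  rw [← he.lintegral_comp hf, ← he.lintegral_comp hg, ← he.lintegral_comp hh]
  refine hμ ha hb hab (hf.comp he.measurable) (hg.comp he.measurable) (hh.comp he.measurable)
    fun x y => ?_
  simpa [hlin] using hfgh (e x) (e y)

theorem PrekopaLeindler.pi_fin {E : Type*} [AddCommGroup E] [Module ℝ E] [MeasureSpace E]
    [SigmaFinite (volume : Measure E)] (hE : PrekopaLeindler (volume : Measure E)) (n : ℕ) :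
    PrekopaLeindler (volume : Measure (Fin n → E)) := by
  induction n with
  | zero =>
    intro a b ha hb hab f g h _ _ _ hfgh
    have e : ∀ u : (Fin 0 → E) → ENNReal, ∫⁻ x, u x = u default := fun u => by
      rw [lintegral_unique, volume_pi, Measure.pi_univ]; simp
    rw [e, e, e]
    exact (hfgh default default).trans (le_of_eq (congrArg h (Subsingleton.elim _ _)))
  | succ n ih =>
    refine (hE.prod ih).of_measurePreserving
      (volume_preserving_piFinSuccAbove (fun _ : Fin (n + 1) => E) 0).symm fun a b x y => ?_
    ext i
    refine Fin.cases ?_ (fun j => ?_) i <;> simp [MeasurableEquiv.piFinSuccAbove]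

theorem prekopaLeindler_euclideanSpace (d : ℕ) :
    PrekopaLeindler (volume : Measure (EuclideanSpace ℝ (Fin d))) :=
  (prekopaLeindler_real.pi_fin d).of_measurePreserving (PiLp.volume_preserving_toLp (Fin d))
    fun _ _ _ _ => rfl

/-- Marginals of strongly log-concave densities are strongly log-concave, when the strong convexity
of the potential is measured in the remaining variable. -/
theorem PrekopaLeindler.strongConvexOn_neg_log_integral {E Z : Type*} [AddCommGroup E]
    [Module ℝ E] [MeasurableSpace E] [NormedAddCommGroup Z] [NormedSpace ℝ Z] {μ : Measure E}
    [NeZero μ] (hμ : PrekopaLeindler μ) {c : ℝ} {Φ : E → Z → ℝ}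
    (hmeas : ∀ z, Measurable fun w => Φ w z)
    (hint : ∀ z, Integrable (fun w => Real.exp (-Φ w z)) μ)
    (hconv : ∀ ⦃a b : ℝ⦄, 0 < a → 0 < b → a + b = 1 → ∀ w w' z z',
      Φ (a • w + b • w') (a • z + b • z') ≤
        a * Φ w z + b * Φ w' z' - a * b * (c / 2 * ‖z - z'‖ ^ 2)) :
    StrongConvexOn Set.univ c fun z => -Real.log (∫ w, Real.exp (-Φ w z) ∂μ) := by
  refine ⟨convex_univ, fun x _ y _ a b ha hb hab => ?_⟩
  rcases ha.eq_or_lt with rfl | ha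
  · obtain rfl : b = 1 := by linarith
    simp
  rcases hb.eq_or_lt with rfl | hb
  · obtain rfl : a = 1 := by linarith
    simp
  set δ := a * b * (c / 2 * ‖x - y‖ ^ 2)
  have pos : ∀ z, 0 < ∫ w, Real.exp (-Φ w z) ∂μ := fun z => integral_exp_pos (hint z)
  have lint : ∀ z, ∫⁻ w, ENNReal.ofReal (Real.exp (-Φ w z)) ∂μ =
      ENNReal.ofReal (∫ w, Real.exp (-Φ w z) ∂μ) := fun z =>
    (ofReal_integral_eq_lintegral_ofReal (hint z) (ae_of_all _ fun _ => (Real.exp_pos _).le)).symm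
  have meas : ∀ z, Measurable fun w => ENNReal.ofReal (Real.exp (-Φ w z)) := fun z =>
    (hmeas z).neg.exp.ennreal_ofReal
  have key := hμ ha hb hab (meas x) (meas y)
    ((meas (a • x + b • y)).const_mul (ENNReal.ofReal (Real.exp (-δ)))) fun w w' => by
      rw [ENNReal.ofReal_rpow_of_pos (Real.exp_pos _), ENNReal.ofReal_rpow_of_pos (Real.exp_pos _),
        ← ENNReal.ofReal_mul (by positivity), ← ENNReal.ofReal_mul (by positivity),
        ← Real.exp_mul, ← Real.exp_mul, ← Real.exp_add, ← Real.exp_add]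
      refine ENNReal.ofReal_le_ofReal (Real.exp_le_exp.2 ?_)
      have : Φ (a • w + b • w') (a • x + b • y) ≤ a * Φ w x + b * Φ w' y - δ :=
        hconv ha hb hab w w' x y
      linarith
  rw [lintegral_const_mul _ (meas _), lint, lint, lint, ENNReal.ofReal_rpow_of_pos (pos x),
    ENNReal.ofReal_rpow_of_pos (pos y), ← ENNReal.ofReal_mul (Real.rpow_nonneg (pos x).le _),
    ← ENNReal.ofReal_mul (Real.exp_pos _).le,
    ENNReal.ofReal_le_ofReal_iff (mul_pos (Real.exp_pos _) (pos _)).le] at key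
  have hlog := Real.log_le_log
    (mul_pos (Real.rpow_pos_of_pos (pos x) a) (Real.rpow_pos_of_pos (pos y) b)) key
  rw [Real.log_mul (Real.rpow_pos_of_pos (pos x) a).ne' (Real.rpow_pos_of_pos (pos y) b).ne',
    Real.log_mul (Real.exp_pos _).ne' (pos _).ne', Real.log_rpow (pos x), Real.log_rpow (pos y),
    Real.log_exp] at hlog
  simp only [smul_eq_mul]
  linarith

theorem norm_sq_smul_add_smul {E : Type*} [NormedAddCommGroup E] [InnerProductSpace ℝ E]
    {a b : ℝ} (hab : a + b = 1) (u v : E) :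
    ‖a • u + b • v‖ ^ 2 = a * ‖u‖ ^ 2 + b * ‖v‖ ^ 2 - a * b * ‖u - v‖ ^ 2 := by
  obtain rfl : b = 1 - a := by linarith
  rw [norm_add_sq_real, norm_sub_sq_real, norm_smul, norm_smul, mul_pow, mul_pow,
    Real.norm_eq_abs, Real.norm_eq_abs, sq_abs, sq_abs, real_inner_smul_left, real_inner_smul_right]
  ring

theorem norm_add_sq_le_add_mul {E : Type*} [SeminormedAddCommGroup E] {k l : ℝ} (hk : 0 < k)
    (hl : 0 < l) (u v : E) :
    ‖u + v‖ ^ 2 ≤ (k + l) * (‖u‖ ^ 2 / k + ‖v‖ ^ 2 / l) := by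
  have h : (k + l) * (‖u‖ ^ 2 / k + ‖v‖ ^ 2 / l) - (‖u‖ + ‖v‖) ^ 2 =
      (l * ‖u‖ - k * ‖v‖) ^ 2 / (k * l) := by
    field_simp
    ring
  have h0 : 0 ≤ (l * ‖u‖ - k * ‖v‖) ^ 2 / (k * l) := by positivity
  have h1 : ‖u + v‖ ^ 2 ≤ (‖u‖ + ‖v‖) ^ 2 := by gcongr; exact norm_add_le u v
  linarith

theorem inv_mul_norm_add_add_sq_le {E : Type*} [SeminormedAddCommGroup E] {k l p : ℝ}
    (hk : 0 < k) (hl : 0 < l) (hp : 0 < p) (u v w : E) :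
    (k + l + p)⁻¹ * ‖u + v + w‖ ^ 2 ≤ ‖u‖ ^ 2 / k + ‖v‖ ^ 2 / l + ‖w‖ ^ 2 / p := by
  rw [inv_mul_le_iff₀ (by positivity)]
  refine (norm_add_sq_le_add_mul (add_pos hk hl) hp (u + v) w).trans ?_
  gcongr
  rw [div_le_iff₀' (add_pos hk hl)]
  exact norm_add_sq_le_add_mul hk hl u v

/-- A weighted average satisfies a crude quadratic bound. -/
theorem norm_average_sq_le {ι E : Type*} [Fintype ι] [SeminormedAddCommGroup E]
    [NormedSpace ℝ E] {w : ι → ℝ} (hw : ∀ i, 0 ≤ w i) (hw' : 0 < ∑ i, w i) (x : ι → E) :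
    ‖(∑ i, w i)⁻¹ • ∑ i, w i • x i‖ ^ 2 ≤ Fintype.card ι * ∑ i, ‖x i‖ ^ 2 := by
  have h : ‖(∑ i, w i)⁻¹ • ∑ i, w i • x i‖ ≤ ∑ i, ‖x i‖ := by
    rw [norm_smul, norm_inv, Real.norm_of_nonneg hw'.le, inv_mul_le_iff₀ hw', Finset.mul_sum]
    refine (norm_sum_le _ _).trans (Finset.sum_le_sum fun i _ => ?_)
    rw [norm_smul, Real.norm_of_nonneg (hw i)]
    gcongr
    exact Finset.single_le_sum (fun i _ => hw i) (Finset.mem_univ i)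
  calc ‖(∑ i, w i)⁻¹ • ∑ i, w i • x i‖ ^ 2 ≤ (∑ i, ‖x i‖) ^ 2 := by gcongr
    _ ≤ Fintype.card ι * ∑ i, ‖x i‖ ^ 2 := sq_sum_le_card_mul_sum_sq

theorem ciInf_pos_of_finite {ι : Type*} [Finite ι] [Nonempty ι] {u : ι → ℝ} (hu : ∀ i, 0 < u i) :
    0 < ⨅ i, u i := by
  obtain ⟨i, hi⟩ := exists_eq_ciInf_of_finite (f := u)
  exact hi ▸ hu i

/-- The quadratic form bound behind the strong convexity constant of the interpolated marginal:
here `x`, `y`, `z` stand for increments of the variables. -/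
theorem bipartite_inv_mul_sum_norm_sq_le {ι κ E : Type*} [Fintype ι] [Fintype κ] [Nonempty ι]
    [Nonempty κ] [SeminormedAddCommGroup E] [NormedSpace ℝ E] {η t : ℝ} (hη : 0 < η)
    (ht : t ∈ Set.Ioo (0 : ℝ) 1) {α : ι → ℝ} {β : κ → ℝ} (hα : ∀ i, 0 < α i) (hβ : ∀ j, 0 < β j)
    {σ : ι → κ → ℝ} (hσ : ∀ i j, 0 ≤ σ i j) (hcol : ∀ j, 0 < ∑ i, σ i j)
    (x : ι → E) (y z : κ → E) :
    (η * t * (1 - t) / (⨅ j, ∑ i, σ i j)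
        + (Fintype.card κ : ℝ) * Fintype.card ι * (1 - t) ^ 2 / (⨅ i, α i)
        + t ^ 2 / (⨅ j, β j))⁻¹ * ∑ j, ‖z j‖ ^ 2 ≤
      ∑ i, α i * ‖x i‖ ^ 2 + ∑ j, β j * ‖y j‖ ^ 2 + ∑ j, (∑ i, σ i j) / (t * (1 - t) * η) *
        ‖z j - t • y j - (1 - t) • ((∑ i, σ i j)⁻¹ • ∑ i, σ i j • x i)‖ ^ 2 := by
  obtain ⟨ht0, ht1⟩ := ht
  have ht1' : 0 < 1 - t := sub_pos.2 ht1
  set S := ⨅ j, ∑ i, σ i j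
  set A := ⨅ i, α i
  set B := ⨅ j, β j
  have hS : 0 < S := ciInf_pos_of_finite hcol
  have hA : 0 < A := ciInf_pos_of_finite hα
  have hB : 0 < B := ciInf_pos_of_finite hβ
  have hn : (0 : ℝ) < Fintype.card ι := by exact_mod_cast Fintype.card_pos
  have hm : (0 : ℝ) < Fintype.card κ := by exact_mod_cast Fintype.card_pos
  set avg : κ → E := fun j => (∑ i, σ i j)⁻¹ • ∑ i, σ i j • x i
  have hz : ∀ j, (η * t * (1 - t) / S + (Fintype.card κ : ℝ) * Fintype.card ι * (1 - t) ^ 2 / A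
        + t ^ 2 / B)⁻¹ * ‖z j‖ ^ 2 ≤
      A / Fintype.card κ * ∑ i, ‖x i‖ ^ 2 + β j * ‖y j‖ ^ 2 +
        (∑ i, σ i j) / (t * (1 - t) * η) * ‖z j - t • y j - (1 - t) • avg j‖ ^ 2 := by
    intro j
    have h := inv_mul_norm_add_add_sq_le (k := η * t * (1 - t) / S)
      (l := (Fintype.card κ : ℝ) * Fintype.card ι * (1 - t) ^ 2 / A) (p := t ^ 2 / B)
      (by positivity) (by positivity) (by positivity)
      (z j - t • y j - (1 - t) • avg j) ((1 - t) • avg j) (t • y j)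
    have e : z j - t • y j - (1 - t) • avg j + (1 - t) • avg j + t • y j = z j := by abel
    rw [e] at h
    have h1 : ‖z j - t • y j - (1 - t) • avg j‖ ^ 2 / (η * t * (1 - t) / S) ≤
        (∑ i, σ i j) / (t * (1 - t) * η) * ‖z j - t • y j - (1 - t) • avg j‖ ^ 2 := by
      rw [div_div_eq_mul_div, mul_comm, mul_div_right_comm,
        show η * t * (1 - t) = t * (1 - t) * η by ring]
      gcongr
      exact ciInf_le (Set.finite_range _).bddBelow j
    have h2 : ‖(1 - t) • avg j‖ ^ 2 /
          ((Fintype.card κ : ℝ) * Fintype.card ι * (1 - t) ^ 2 / A) ≤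
        A / Fintype.card κ * ∑ i, ‖x i‖ ^ 2 := by
      have := norm_average_sq_le (fun i => hσ i j) (hcol j) x
      rw [norm_smul, Real.norm_of_nonneg ht1'.le]
      calc ((1 - t) * ‖avg j‖) ^ 2 / ((Fintype.card κ : ℝ) * Fintype.card ι * (1 - t) ^ 2 / A)
          = A / Fintype.card κ / Fintype.card ι * ‖avg j‖ ^ 2 := by field_simp
        _ ≤ A / Fintype.card κ / Fintype.card ι * (Fintype.card ι * ∑ i, ‖x i‖ ^ 2) := by gcongr
        _ = A / Fintype.card κ * ∑ i, ‖x i‖ ^ 2 := by field_simp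
    have h3 : ‖t • y j‖ ^ 2 / (t ^ 2 / B) ≤ β j * ‖y j‖ ^ 2 := by
      rw [norm_smul, Real.norm_of_nonneg ht0.le]
      calc (t * ‖y j‖) ^ 2 / (t ^ 2 / B) = B * ‖y j‖ ^ 2 := by field_simp
        _ ≤ β j * ‖y j‖ ^ 2 := by
          gcongr
          exact ciInf_le (Set.finite_range _).bddBelow j
    linarith
  rw [Finset.mul_sum]
  refine (Finset.sum_le_sum fun j _ => hz j).trans ?_
  rw [Finset.sum_add_distrib, Finset.sum_add_distrib, Finset.sum_const, Finset.card_univ,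
    nsmul_eq_mul, ← mul_assoc, mul_div_cancel₀ _ hm.ne', Finset.mul_sum]
  gcongr with i
  exact ciInf_le (Set.finite_range _).bddBelow i

theorem StrongConvexOn.continuous {d : ℕ} {c : ℝ} (hc : 0 ≤ c)
    {f : EuclideanSpace ℝ (Fin d) → ℝ} (hf : StrongConvexOn Set.univ c f) : Continuous f :=
  continuousOn_univ.1 ((strongConvexOn_zero.1 (hf.mono hc)).continuousOn isOpen_univ)

/-- The negative logarithm of the joint density of `((x, y), z)`. -/
def bipartitePotential {n m d : ℕ} (η t : ℝ) (f : Fin n → EuclideanSpace ℝ (Fin d) → ℝ)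
    (g : Fin m → EuclideanSpace ℝ (Fin d) → ℝ) (σ : Fin n → Fin m → ℝ)
    (w : (Fin n → EuclideanSpace ℝ (Fin d)) × (Fin m → EuclideanSpace ℝ (Fin d)))
    (z : PiLp 2 (fun _ : Fin m => EuclideanSpace ℝ (Fin d))) : ℝ :=
  ∑ i, f i (w.1 i) + ∑ j, g j (w.2 j) + ∑ i, ∑ j, σ i j / (2 * η) * ‖w.1 i - w.2 j‖ ^ 2 +
    ∑ j, (∑ i, σ i j) / (2 * t * (1 - t) * η) *
      ‖z j - t • w.2 j - (1 - t) • ((∑ i, σ i j)⁻¹ • ∑ i, σ i j • w.1 i)‖ ^ 2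

theorem integrable_exp_neg_bipartitePotential {n m d : ℕ} {η t : ℝ} (hη : 0 < η)
    (ht : t ∈ Set.Ioo (0 : ℝ) 1) {f : Fin n → EuclideanSpace ℝ (Fin d) → ℝ}
    {g : Fin m → EuclideanSpace ℝ (Fin d) → ℝ} {σ : Fin n → Fin m → ℝ}
    (hσ : ∀ i j, 0 ≤ σ i j) (hfint : ∀ i, Integrable (fun x => Real.exp (-f i x)))
    (hgint : ∀ j, Integrable (fun y => Real.exp (-g j y)))
    (z : PiLp 2 (fun _ : Fin m => EuclideanSpace ℝ (Fin d)))
    (hmeas : Measurable fun w => bipartitePotential η t f g σ w z) :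
    Integrable fun w => Real.exp (-bipartitePotential η t f g σ w z) := by
  have ht1 : 0 < 1 - t := sub_pos.2 ht.2
  have ht0 := ht.1
  have h : Integrable fun w : (Fin n → EuclideanSpace ℝ (Fin d)) ×
      (Fin m → EuclideanSpace ℝ (Fin d)) =>
      (∏ i, Real.exp (-f i (w.1 i))) * ∏ j, Real.exp (-g j (w.2 j)) :=
    (Integrable.fintype_prod hfint).mul_prod (Integrable.fintype_prod hgint)
  refine h.mono' hmeas.neg.exp.aestronglyMeasurable (ae_of_all _ fun w => ?_)
  rw [Real.norm_of_nonneg (Real.exp_pos _).le, ← Real.exp_sum, ← Real.exp_sum, ← Real.exp_add,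
    Real.exp_le_exp, Finset.sum_neg_distrib, Finset.sum_neg_distrib, bipartitePotential]
  have h1 : 0 ≤ ∑ i, ∑ j, σ i j / (2 * η) * ‖w.1 i - w.2 j‖ ^ 2 :=
    Finset.sum_nonneg fun i _ => Finset.sum_nonneg fun j _ =>
      mul_nonneg (div_nonneg (hσ i j) (by positivity)) (by positivity)
  have h2 : 0 ≤ ∑ j, (∑ i, σ i j) / (2 * t * (1 - t) * η) *
      ‖z j - t • w.2 j - (1 - t) • ((∑ i, σ i j)⁻¹ • ∑ i, σ i j • w.1 i)‖ ^ 2 :=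
    Finset.sum_nonneg fun j _ => mul_nonneg
      (div_nonneg (Finset.sum_nonneg fun i _ => hσ i j) (by positivity)) (by positivity)
  linarith

theorem bipartitePotential_smul_add_smul_le {n m d : ℕ} [NeZero n] [NeZero m] {η t : ℝ}
    (hη : 0 < η) (ht : t ∈ Set.Ioo (0 : ℝ) 1) {f : Fin n → EuclideanSpace ℝ (Fin d) → ℝ}
    {g : Fin m → EuclideanSpace ℝ (Fin d) → ℝ} {α : Fin n → ℝ} {β : Fin m → ℝ}
    (hα : ∀ i, 0 < α i) (hβ : ∀ j, 0 < β j)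
    (hf : ∀ i, StrongConvexOn Set.univ (α i) (f i))
    (hg : ∀ j, StrongConvexOn Set.univ (β j) (g j))
    {σ : Fin n → Fin m → ℝ} (hσ : ∀ i j, 0 ≤ σ i j) (hcol : ∀ j, 0 < ∑ i, σ i j)
    {a b : ℝ} (ha : 0 < a) (hb : 0 < b) (hab : a + b = 1)
    (w w' : (Fin n → EuclideanSpace ℝ (Fin d)) × (Fin m → EuclideanSpace ℝ (Fin d)))
    (z z' : PiLp 2 (fun _ : Fin m => EuclideanSpace ℝ (Fin d))) :
    bipartitePotential η t f g σ (a • w + b • w') (a • z + b • z') ≤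
      a * bipartitePotential η t f g σ w z + b * bipartitePotential η t f g σ w' z' -
        a * b * ((η * t * (1 - t) / (⨅ j, ∑ i, σ i j) + (m : ℝ) * n * (1 - t) ^ 2 / (⨅ i, α i)
          + t ^ 2 / (⨅ j, β j))⁻¹ / 2 * ‖z - z'‖ ^ 2) := by
  have hF : ∑ i, f i ((a • w + b • w').1 i) ≤ a * ∑ i, f i (w.1 i) + b * ∑ i, f i (w'.1 i) -
      a * b * (1 / 2 * ∑ i, α i * ‖w.1 i - w'.1 i‖ ^ 2) := by
    simp only [Finset.mul_sum, ← Finset.sum_add_distrib, ← Finset.sum_sub_distrib]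
    refine Finset.sum_le_sum fun i _ => ?_
    have := (hf i).2 (Set.mem_univ (w.1 i)) (Set.mem_univ (w'.1 i)) ha.le hb.le hab
    simp only [smul_eq_mul] at this
    refine this.trans (le_of_eq (by ring))
  have hG : ∑ j, g j ((a • w + b • w').2 j) ≤ a * ∑ j, g j (w.2 j) + b * ∑ j, g j (w'.2 j) -
      a * b * (1 / 2 * ∑ j, β j * ‖w.2 j - w'.2 j‖ ^ 2) := by
    simp only [Finset.mul_sum, ← Finset.sum_add_distrib, ← Finset.sum_sub_distrib]
    refine Finset.sum_le_sum fun j _ => ?_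
    have := (hg j).2 (Set.mem_univ (w.2 j)) (Set.mem_univ (w'.2 j)) ha.le hb.le hab
    simp only [smul_eq_mul] at this
    refine this.trans (le_of_eq (by ring))
  have hQ : ∑ i, ∑ j, σ i j / (2 * η) * ‖(a • w + b • w').1 i - (a • w + b • w').2 j‖ ^ 2 ≤
      a * ∑ i, ∑ j, σ i j / (2 * η) * ‖w.1 i - w.2 j‖ ^ 2 +
        b * ∑ i, ∑ j, σ i j / (2 * η) * ‖w'.1 i - w'.2 j‖ ^ 2 := by
    simp only [Finset.mul_sum, ← Finset.sum_add_distrib]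
    refine Finset.sum_le_sum fun i _ => Finset.sum_le_sum fun j _ => ?_
    have e : (a • w + b • w').1 i - (a • w + b • w').2 j =
        a • (w.1 i - w.2 j) + b • (w'.1 i - w'.2 j) := by
      simp only [Prod.fst_add, Prod.snd_add, Prod.smul_fst, Prod.smul_snd, Pi.add_apply,
        Pi.smul_apply]
      module
    have h0 : 0 ≤ σ i j / (2 * η) := div_nonneg (hσ i j) (by positivity)
    rw [e, norm_sq_smul_add_smul hab]
    have := mul_nonneg h0 (by positivity :
      0 ≤ a * b * ‖w.1 i - w.2 j - (w'.1 i - w'.2 j)‖ ^ 2)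
    linarith
  have hR : ∑ j, (∑ i, σ i j) / (2 * t * (1 - t) * η) *
        ‖(a • z + b • z') j - t • (a • w + b • w').2 j -
          (1 - t) • ((∑ i, σ i j)⁻¹ • ∑ i, σ i j • (a • w + b • w').1 i)‖ ^ 2 =
      a * ∑ j, (∑ i, σ i j) / (2 * t * (1 - t) * η) *
        ‖z j - t • w.2 j - (1 - t) • ((∑ i, σ i j)⁻¹ • ∑ i, σ i j • w.1 i)‖ ^ 2 +
      b * ∑ j, (∑ i, σ i j) / (2 * t * (1 - t) * η) *
        ‖z' j - t • w'.2 j - (1 - t) • ((∑ i, σ i j)⁻¹ • ∑ i, σ i j • w'.1 i)‖ ^ 2 -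
      a * b * (1 / 2 * ∑ j, (∑ i, σ i j) / (t * (1 - t) * η) *
        ‖(z j - z' j) - t • (w.2 j - w'.2 j) -
          (1 - t) • ((∑ i, σ i j)⁻¹ • ∑ i, σ i j • (w.1 i - w'.1 i))‖ ^ 2) := by
    simp only [Finset.mul_sum, ← Finset.sum_add_distrib, ← Finset.sum_sub_distrib]
    refine Finset.sum_congr rfl fun j _ => ?_
    have e1 : (a • z + b • z') j - t • (a • w + b • w').2 j -
          (1 - t) • ((∑ i, σ i j)⁻¹ • ∑ i, σ i j • (a • w + b • w').1 i) =
        a • (z j - t • w.2 j - (1 - t) • ((∑ i, σ i j)⁻¹ • ∑ i, σ i j • w.1 i)) +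
          b • (z' j - t • w'.2 j - (1 - t) • ((∑ i, σ i j)⁻¹ • ∑ i, σ i j • w'.1 i)) := by
      have : ∑ i, σ i j • (a • w + b • w').1 i =
          a • ∑ i, σ i j • w.1 i + b • ∑ i, σ i j • w'.1 i := by
        simp only [Finset.smul_sum, ← Finset.sum_add_distrib]
        refine Finset.sum_congr rfl fun i _ => ?_
        simp only [Prod.fst_add, Prod.smul_fst, Pi.add_apply, Pi.smul_apply]
        module
      rw [this]
      simp only [Prod.snd_add, Prod.smul_snd, Pi.add_apply, Pi.smul_apply, PiLp.add_apply,
        PiLp.smul_apply]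
      module
    have e2 : (z j - z' j) - t • (w.2 j - w'.2 j) -
          (1 - t) • ((∑ i, σ i j)⁻¹ • ∑ i, σ i j • (w.1 i - w'.1 i)) =
        (z j - t • w.2 j - (1 - t) • ((∑ i, σ i j)⁻¹ • ∑ i, σ i j • w.1 i)) -
          (z' j - t • w'.2 j - (1 - t) • ((∑ i, σ i j)⁻¹ • ∑ i, σ i j • w'.1 i)) := by
      simp only [smul_sub, Finset.sum_sub_distrib]
      module
    rw [e1, e2, norm_sq_smul_add_smul hab]
    have h2 : (∑ i, σ i j) / (2 * t * (1 - t) * η) =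
        1 / 2 * ((∑ i, σ i j) / (t * (1 - t) * η)) := by
      rw [div_mul_div_comm, one_mul]; ring_nf
    rw [h2]
    ring
  have hz := bipartite_inv_mul_sum_norm_sq_le hη ht hα hβ hσ hcol
    (fun i => w.1 i - w'.1 i) (fun j => w.2 j - w'.2 j) (fun j => z j - z' j)
  simp only [Fintype.card_fin] at hz
  have hnorm : ‖z - z'‖ ^ 2 = ∑ j, ‖z j - z' j‖ ^ 2 := by
    rw [PiLp.norm_sq_eq_of_L2]; rfl
  have := mul_le_mul_of_nonneg_left hz (by positivity : 0 ≤ a * b * (1 / 2))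
  rw [hnorm]
  simp only [bipartitePotential]
  linarith

/-- strong log-concavity of the interpolated marginal over a bipartite
graph: the negative log of the (unnormalized) `z`-marginal density is strongly convex
with constant `c_t = [ηt(1−t)/min_j Σ_i σ_{ij} + mn(1−t)²/min_i α_{f_i} + t²/min_j α_{g_j}]⁻¹`. -/
theorem bipartite_interpolated_marginal_strong_logconcave
    (n m d : ℕ) (hn : 1 ≤ n) (hm : 1 ≤ m) (hd : 1 ≤ d)
    (η : ℝ) (hη : 0 < η) (t : ℝ) (ht : t ∈ Set.Ioo (0 : ℝ) 1)
    (f : Fin n → EuclideanSpace ℝ (Fin d) → ℝ)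
    (g : Fin m → EuclideanSpace ℝ (Fin d) → ℝ)
    (αf : Fin n → ℝ) (αg : Fin m → ℝ)
    (hαf : ∀ i, 0 < αf i) (hαg : ∀ j, 0 < αg j)
    (hf : ∀ i, StrongConvexOn Set.univ (αf i) (f i))
    (hg : ∀ j, StrongConvexOn Set.univ (αg j) (g j))
    (hfint : ∀ i, Integrable (fun x => Real.exp (-f i x)))
    (hgint : ∀ j, Integrable (fun y => Real.exp (-g j y)))
    (σ : Fin n → Fin m → ℝ) (hσ : ∀ i j, σ i j ∈ Set.Icc (0 : ℝ) 1)
    (hcol : ∀ j, 0 < ∑ i, σ i j) (hrow : ∀ i, 0 < ∑ j, σ i j) :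
    StrongConvexOn Set.univ
      (η * t * (1 - t) / (⨅ j, ∑ i, σ i j)
        + (m : ℝ) * n * (1 - t) ^ 2 / (⨅ i, αf i)
        + t ^ 2 / (⨅ j, αg j))⁻¹
      (fun z : PiLp 2 (fun _ : Fin m => EuclideanSpace ℝ (Fin d)) =>
        - Real.log (∫ x : Fin n → EuclideanSpace ℝ (Fin d),
            ∫ y : Fin m → EuclideanSpace ℝ (Fin d),
              Real.exp (- ∑ i, f i (x i) - ∑ j, g j (y j)
                - ∑ i, ∑ j, σ i j / (2 * η) * ‖x i - y j‖ ^ 2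
                - ∑ j, (∑ i, σ i j) / (2 * t * (1 - t) * η) *
                    ‖z j - t • y j -
                      (1 - t) • ((∑ i, σ i j)⁻¹ • ∑ i, σ i j • x i)‖ ^ 2))) := by
  have : NeZero n := ⟨by lia⟩
  have : NeZero m := ⟨by lia⟩
  have hσ0 : ∀ i j, 0 ≤ σ i j := fun i j => (hσ i j).1
  have hfc : ∀ i, Continuous (f i) := fun i => (hf i).continuous (hαf i).le
  have hgc : ∀ j, Continuous (g j) := fun j => (hg j).continuous (hαg j).le
  have hmeas : ∀ z, Measurable fun w => bipartitePotential η t f g σ w z := fun z => by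
    have : Continuous fun w => bipartitePotential η t f g σ w z := by
      unfold bipartitePotential
      fun_prop
    exact this.measurable
  have hint := fun z =>
    integrable_exp_neg_bipartitePotential hη ht hσ0 hfint hgint z (hmeas z)
  have hPL := ((prekopaLeindler_euclideanSpace d).pi_fin n).prod
    ((prekopaLeindler_euclideanSpace d).pi_fin m)
  have : NeZero ((volume : Measure (Fin n → EuclideanSpace ℝ (Fin d))).prod
      (volume : Measure (Fin m → EuclideanSpace ℝ (Fin d)))) :=
    ⟨Measure.measure_univ_ne_zero.1 (by
      rw [← Set.univ_prod_univ, Measure.prod_prod]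
      exact mul_ne_zero (Measure.measure_univ_ne_zero.2 (NeZero.ne _))
        (Measure.measure_univ_ne_zero.2 (NeZero.ne _)))⟩
  have key := hPL.strongConvexOn_neg_log_integral hmeas hint fun a b ha hb hab w w' z z' =>
    bipartitePotential_smul_add_smul_le hη ht hαf hαg hf hg hσ0 hcol ha hb hab w w' z z'
  convert key using 4 with z
  rw [integral_prod _ (hint z)]
  refine integral_congr_ae (ae_of_all _ fun x => integral_congr_ae (ae_of_all _ fun y => ?_))
  simp only [bipartitePotential]
  congr 1
  ring

end
end
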